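/- arXiv:1902.03241 — 2 statements merged into one kernel-verified Lean document; each statement's English description precedes it below -/
import Mathlib

section
/- (Fourier transform of the influence function, Eq. (E34).) For every x ∈ ℝ^d and t ∈ ℝ^d, (2π)^{−d} ∫_{ℝ^d} f_x(z) exp(−i tᵀz) dz = (4πσ)^{−d/2} · { exp(−i xᵀt − ‖t‖²/(4σ)) − exp(−i m₀ᵀt − tᵀVt/(4σ)) · ( 1 − i tᵀ(x−m₀) − (1/2) tᵀB(x)t ) }, where f_x : ℝ^d → ℝ is defined by f_x(z) = exp(−σ‖z−x‖²) − det(V)^{−1/2} exp(−σ(z−m₀)ᵀV^{−1}(z−m₀)) · ( 1 + 2σ(z−m₀)ᵀV^{−1}(x−m₀) + σ tr[V^{−1}(2σ(z−m₀)(z−m₀)ᵀV^{−1} − I_d)B(x)] ). -/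
open MeasureTheory Matrix Real

/-- `V = I_d + 2σΣ₀`. -/
noncomputable def Vm {d : ℕ} (σ : ℝ) (S : Matrix (Fin d) (Fin d) ℝ) :
    Matrix (Fin d) (Fin d) ℝ :=
  1 + (2 * σ) • S

/-- `B(x) = (x−m₀)(x−m₀)ᵀ − Σ₀`. -/
noncomputable def Bm {d : ℕ} (m₀ : Fin d → ℝ) (S : Matrix (Fin d) (Fin d) ℝ)
    (x : Fin d → ℝ) : Matrix (Fin d) (Fin d) ℝ :=
  vecMulVec (x - m₀) (x - m₀) - S

/-- The influence function `f_x(z) = exp(−σ‖z−x‖²) − det(V)^{−1/2} exp(−σ(z−m₀)ᵀV⁻¹(z−m₀)) ·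
(1 + 2σ(z−m₀)ᵀV⁻¹(x−m₀) + σ tr[V⁻¹(2σ(z−m₀)(z−m₀)ᵀV⁻¹ − I_d)B(x)])`. -/
noncomputable def fInfl {d : ℕ} (σ : ℝ) (m₀ : Fin d → ℝ) (S : Matrix (Fin d) (Fin d) ℝ)
    (x z : Fin d → ℝ) : ℝ :=
  Real.exp (-σ * ((z - x) ⬝ᵥ (z - x))) -
    (Vm σ S).det ^ (-(1 : ℝ) / 2) *
      Real.exp (-σ * ((z - m₀) ⬝ᵥ ((Vm σ S)⁻¹ *ᵥ (z - m₀)))) *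
      (1 + 2 * σ * ((z - m₀) ⬝ᵥ ((Vm σ S)⁻¹ *ᵥ (x - m₀))) +
        σ * ((Vm σ S)⁻¹ *
          ((2 * σ) • vecMulVec (z - m₀) (z - m₀) * (Vm σ S)⁻¹ - 1) * Bm m₀ S x).trace)

/-- The Gaussian character `exp(−σw² − isw)` on the real line. -/
noncomputable def gaussChar (σ s w : ℝ) : ℂ :=
  Complex.exp (-(σ : ℂ) * (w : ℂ) ^ 2 - Complex.I * s * w)

/-- The polynomials `1`, `2σw`, `4σ²w² − 2σ`, which satisfy
`hermitePoly σ n w * exp(−σw²) = (−d/dw)ⁿ exp(−σw²)` for `n ≤ 2`. -/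
noncomputable def hermitePoly (σ : ℝ) : ℕ → ℝ → ℂ
  | 0, _ => 1
  | 1, w => 2 * σ * w
  | _ + 2, w => 4 * σ ^ 2 * w ^ 2 - 2 * σ

lemma continuous_gaussChar (σ s : ℝ) : Continuous (gaussChar σ s) := by
  unfold gaussChar
  fun_prop

lemma norm_gaussChar (σ s w : ℝ) : ‖gaussChar σ s w‖ = Real.exp (-σ * w ^ 2) := by
  rw [gaussChar, Complex.norm_exp]
  congr 1
  simp [← Complex.ofReal_pow]

lemma integrable_pow_mul_gaussChar {σ : ℝ} (hσ : 0 < σ) (s : ℝ) (n : ℕ) :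
    Integrable fun w : ℝ => (w : ℂ) ^ n * gaussChar σ s w := by
  have h := integrable_rpow_mul_exp_neg_mul_sq hσ (s := n) (by linarith [n.cast_nonneg (α := ℝ)])
  simp only [Real.rpow_natCast] at h
  refine h.mono (by have := continuous_gaussChar σ s; fun_prop) (ae_of_all _ fun w => ?_)
  simp [norm_gaussChar]

lemma integrable_hermitePoly_mul_gaussChar {σ : ℝ} (hσ : 0 < σ) (s : ℝ) (n : ℕ) :
    Integrable fun w : ℝ => hermitePoly σ n w * gaussChar σ s w := by
  have h (k : ℕ) := integrable_pow_mul_gaussChar hσ s k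
  match n with
  | 0 => simpa [hermitePoly] using h 0
  | 1 => simpa [hermitePoly, mul_assoc] using (h 1).const_mul (2 * (σ : ℂ))
  | _ + 2 =>
    refine (((h 2).const_mul (4 * (σ : ℂ) ^ 2)).sub ((h 0).const_mul (2 * (σ : ℂ)))).congr
      (ae_of_all _ fun w => ?_)
    simp [hermitePoly]
    ring

lemma hasDerivAt_gaussChar (σ s w : ℝ) :
    HasDerivAt (gaussChar σ s) ((-(2 * σ * w) - Complex.I * s) * gaussChar σ s w) w := by
  have hw : HasDerivAt (fun w : ℝ => (w : ℂ)) 1 w := Complex.ofRealCLM.hasDerivAt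
  have := (((hw.pow 2).const_mul (-(σ : ℂ))).sub (hw.const_mul (Complex.I * s))).cexp
  refine this.congr_deriv ?_
  simp [gaussChar]
  ring

lemma integral_gaussChar {σ : ℝ} (hσ : 0 < σ) (s : ℝ) :
    ∫ w, gaussChar σ s w
      = ((Real.sqrt (π / σ) : ℝ) : ℂ) * Complex.exp (-(s : ℂ) ^ 2 / (4 * σ)) := by
  have h := fourierIntegral_gaussian (b := σ) (by simpa using hσ) (-s : ℂ)
  simp only [← Complex.exp_add] at h
  have e : ((Real.sqrt (π / σ) : ℝ) : ℂ) = ((π : ℂ) / σ) ^ (1 / 2 : ℂ) := by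
    rw [Real.sqrt_eq_rpow, Complex.ofReal_cpow (by positivity)]
    simp
  rw [e, ← neg_sq (s : ℂ), ← h]
  refine integral_congr_ae (ae_of_all _ fun w => ?_)
  simp only [gaussChar]
  congr 1
  ring

lemma integral_hermitePoly_mul_gaussChar {σ : ℝ} (hσ : 0 < σ) (s : ℝ) {n : ℕ} (hn : n ≤ 2) :
    ∫ w, hermitePoly σ n w * gaussChar σ s w
      = (-(Complex.I * s)) ^ n * ∫ w, gaussChar σ s w := by
  have hint (k : ℕ) := integrable_hermitePoly_mul_gaussChar hσ s k
  have h0 : Integrable (gaussChar σ s) := by simpa [hermitePoly] using hint 0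
  have hneg (k : ℕ) : Integrable fun w => -(hermitePoly σ k w * gaussChar σ s w) := (hint k).neg
  have hone : ∫ w, hermitePoly σ 1 w * gaussChar σ s w
      = -(Complex.I * s) * ∫ w, gaussChar σ s w := by
    have := integral_eq_zero_of_hasDerivAt_of_integrable
      (f' := fun w => -(hermitePoly σ 1 w * gaussChar σ s w) - (Complex.I * s) * gaussChar σ s w)
      (fun w => (hasDerivAt_gaussChar σ s w).congr_deriv (by simp only [hermitePoly]; ring))
      ((hneg 1).sub (h0.const_mul _)) h0
    rw [integral_sub (hneg 1) (h0.const_mul _), integral_neg, integral_const_mul] at this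
    linear_combination -this
  have htwo : ∫ w, hermitePoly σ 2 w * gaussChar σ s w
      = -(Complex.I * s) * ∫ w, hermitePoly σ 1 w * gaussChar σ s w := by
    have := integral_eq_zero_of_hasDerivAt_of_integrable
      (f := fun w => hermitePoly σ 1 w * gaussChar σ s w)
      (f' := fun w => -(hermitePoly σ 2 w * gaussChar σ s w)
        - (Complex.I * s) * (hermitePoly σ 1 w * gaussChar σ s w))
      (fun w => by
        have hw : HasDerivAt (fun w : ℝ => (w : ℂ)) 1 w := Complex.ofRealCLM.hasDerivAt
        refine ((hw.const_mul (2 * (σ : ℂ))).mul (hasDerivAt_gaussChar σ s w)).congr_deriv ?_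
        simp only [hermitePoly]
        ring)
      ((hneg 2).sub ((hint 1).const_mul _)) (hint 1)
    rw [integral_sub (hneg 2) ((hint 1).const_mul _), integral_neg, integral_const_mul] at this
    linear_combination -this
  interval_cases n
  · simp [hermitePoly]
  · rw [hone, pow_one]
  · rw [htwo, hone]
    ring

section Multivariate

variable {d : ℕ}

lemma integrable_prod_hermitePoly_mul {σ : ℝ} (hσ : 0 < σ) (s : Fin d → ℝ) (n : Fin d → ℕ) :
    Integrable fun w : Fin d → ℝ =>
      (∏ j, hermitePoly σ (n j) (w j)) * ∏ j, gaussChar σ (s j) (w j) := by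
  simp only [← Finset.prod_mul_distrib]
  exact Integrable.fintype_prod (f := fun j v => hermitePoly σ (n j) v * gaussChar σ (s j) v)
    fun j => integrable_hermitePoly_mul_gaussChar hσ (s j) (n j)

lemma integral_prod_hermitePoly_mul {σ : ℝ} (hσ : 0 < σ) (s : Fin d → ℝ) {n : Fin d → ℕ}
    (hn : ∀ j, n j ≤ 2) :
    ∫ w : Fin d → ℝ, (∏ j, hermitePoly σ (n j) (w j)) * ∏ j, gaussChar σ (s j) (w j)
      = (∏ j, (-(Complex.I * s j)) ^ n j) * ∏ j, ∫ w, gaussChar σ (s j) w := by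
  simp only [← Finset.prod_mul_distrib]
  rw [integral_fintype_prod_volume_eq_prod
    (f := fun j v => hermitePoly σ (n j) v * gaussChar σ (s j) v)]
  exact Finset.prod_congr rfl fun j _ => integral_hermitePoly_mul_gaussChar hσ (s j) (hn j)

lemma prod_hermitePoly_single (σ : ℝ) (a : Fin d) (w : Fin d → ℝ) :
    ∏ j, hermitePoly σ ((Pi.single a 1 : Fin d → ℕ) j) (w j) = 2 * σ * w a := by
  rw [Finset.prod_eq_single a]
  · simp [hermitePoly]
  · intro j _ hj
    simp [hj, hermitePoly]
  · simp

lemma prod_hermitePoly_single_add_single (σ : ℝ) (a b : Fin d) (w : Fin d → ℝ) :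
    ∏ j, hermitePoly σ ((Pi.single a 1 + Pi.single b 1 : Fin d → ℕ) j) (w j)
      = 4 * σ ^ 2 * w a * w b - if a = b then 2 * (σ : ℂ) else 0 := by
  rcases eq_or_ne a b with rfl | hab
  · rw [Finset.prod_eq_single a]
    · simp [hermitePoly]
      ring
    · intro j _ hj
      simp [hj, hermitePoly]
    · simp
  · rw [Finset.prod_eq_mul a b hab]
    · simp [hab, hab.symm, hermitePoly]
      ring
    · intro j _ hj
      simp [hj.1, hj.2, hermitePoly]
    · simp
    · simp

lemma prod_pow_single (c : Fin d → ℂ) (a : Fin d) :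
    ∏ j, c j ^ (Pi.single a 1 : Fin d → ℕ) j = c a := by
  rw [Finset.prod_eq_single a]
  · simp
  · intro j _ hj
    simp [hj]
  · simp

lemma quadratic_mul_gaussChar {σ : ℝ} (hσ : 0 < σ) (s u : Fin d → ℝ)
    (C : Matrix (Fin d) (Fin d) ℝ) :
    Integrable (fun w : Fin d → ℝ =>
      (((1 + 2 * σ * (w ⬝ᵥ u) +
        σ * (((2 * σ) • vecMulVec w w - 1) * C).trace : ℝ)) : ℂ) *
          ∏ j, gaussChar σ (s j) (w j)) ∧
    ∫ w : Fin d → ℝ, (((1 + 2 * σ * (w ⬝ᵥ u) +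
        σ * (((2 * σ) • vecMulVec w w - 1) * C).trace : ℝ)) : ℂ) *
          ∏ j, gaussChar σ (s j) (w j)
      = (1 - Complex.I * ((s ⬝ᵥ u : ℝ) : ℂ) - (1 / 2) * ((s ⬝ᵥ (C *ᵥ s) : ℝ) : ℂ)) *
        ∏ j, ∫ w, gaussChar σ (s j) w := by
  set h : (Fin d → ℕ) → (Fin d → ℝ) → ℂ := fun n w =>
    (∏ j, hermitePoly σ (n j) (w j)) * ∏ j, gaussChar σ (s j) (w j) with hh
  have hint (n) : Integrable (h n) := integrable_prod_hermitePoly_mul hσ s n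
  have hpt : (fun w : Fin d → ℝ => (((1 + 2 * σ * (w ⬝ᵥ u) +
      σ * (((2 * σ) • vecMulVec w w - 1) * C).trace : ℝ)) : ℂ) * ∏ j, gaussChar σ (s j) (w j))
      = fun w => h 0 w + ∑ a, (u a : ℂ) * h (Pi.single a 1) w
        + ∑ a, ∑ b, (C b a / 2 : ℂ) * h (Pi.single a 1 + Pi.single b 1) w := by
    funext w
    simp only [hh, prod_hermitePoly_single, prod_hermitePoly_single_add_single, ← mul_assoc,
      ← Finset.sum_mul, ← add_mul]
    congr 1
    have ht : (((2 * σ) • vecMulVec w w - 1) * C).trace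
        = ∑ a, ∑ b, (2 * σ * (w a * w b) - if a = b then 1 else 0) * C b a := by
      simp [Matrix.trace, Matrix.mul_apply, vecMulVec_apply, Matrix.one_apply]
    rw [ht]
    simp only [dotProduct, hermitePoly, Finset.mul_sum, Finset.prod_const_one]
    push_cast
    congr 1
    · congr 1
      exact Finset.sum_congr rfl fun a _ => by ring
    · refine Finset.sum_congr rfl fun a _ => Finset.sum_congr rfl fun b _ => ?_
      split_ifs <;> push_cast <;> ring
  have hi1 : Integrable fun w => ∑ a, (u a : ℂ) * h (Pi.single a 1) w :=
    integrable_finsetSum _ fun a _ => (hint _).const_mul _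
  have hi2 : Integrable fun w =>
      ∑ a, ∑ b, (C b a / 2 : ℂ) * h (Pi.single a 1 + Pi.single b 1) w :=
    integrable_finsetSum _ fun a _ => integrable_finsetSum _ fun b _ => (hint _).const_mul _
  have hi01 : Integrable fun w => h 0 w + ∑ a, (u a : ℂ) * h (Pi.single a 1) w := (hint 0).add hi1
  rw [hpt]
  refine ⟨hi01.add hi2, ?_⟩
  have hv0 : ∫ w, h 0 w = ∏ j, ∫ w, gaussChar σ (s j) w := by
    rw [hh, integral_prod_hermitePoly_mul hσ s (by simp)]
    simp
  have hv1 (a) : ∫ w, h (Pi.single a 1) w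
      = -(Complex.I * s a) * ∏ j, ∫ w, gaussChar σ (s j) w := by
    rw [hh, integral_prod_hermitePoly_mul hσ s, prod_pow_single (fun j => -(Complex.I * s j))]
    intro j
    simp only [Pi.single_apply]
    split_ifs <;> omega
  have hv2 (a b) : ∫ w, h (Pi.single a 1 + Pi.single b 1) w
      = -(s a * s b) * ∏ j, ∫ w, gaussChar σ (s j) w := by
    rw [hh, integral_prod_hermitePoly_mul hσ s]
    · simp only [Pi.add_apply, pow_add, Finset.prod_mul_distrib]
      rw [prod_pow_single (fun j => -(Complex.I * s j)),
        prod_pow_single (fun j => -(Complex.I * s j))]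
      linear_combination
        ((s a : ℂ) * s b * ∏ j, ∫ w, gaussChar σ (s j) w) * Complex.I_mul_I
    · intro j
      simp only [Pi.add_apply, Pi.single_apply]
      split_ifs <;> omega
  rw [integral_add hi01 hi2, integral_add (hint 0) hi1,
    integral_finsetSum _ fun a _ => (hint _).const_mul _,
    integral_finsetSum _ fun a _ => integrable_finsetSum _ fun b _ => (hint _).const_mul _]
  simp only [integral_finsetSum _ fun b _ => (hint _).const_mul _, integral_const_mul, hv0, hv1,
    hv2, ← mul_assoc, ← Finset.sum_mul]
  have hfac (P X Y : ℂ) : P + X * P + Y * P = (1 + X + Y) * P := by ring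
  rw [hfac]
  congr 1
  simp only [dotProduct, mulVec, Finset.mul_sum]
  rw [Finset.sum_comm]
  push_cast
  simp only [Finset.mul_sum]
  rw [sub_eq_add_neg, sub_eq_add_neg, ← Finset.sum_neg_distrib, ← Finset.sum_neg_distrib]
  congr 1
  · congr 1
    exact Finset.sum_congr rfl fun a _ => by ring
  · refine Finset.sum_congr rfl fun a _ => ?_
    rw [← Finset.sum_neg_distrib]
    exact Finset.sum_congr rfl fun b _ => by ring

lemma integral_comp_affine {A : Matrix (Fin d) (Fin d) ℝ} (hA : A.det ≠ 0) (m : Fin d → ℝ)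
    {F : (Fin d → ℝ) → ℂ} (hF : Integrable fun w => F (m + A *ᵥ w)) :
    Integrable F ∧ ∫ z, F z = |A.det| * ∫ w, F (m + A *ᵥ w) := by
  set f : (Fin d → ℝ) → (Fin d → ℝ) := fun w => m + A *ᵥ w
  set A' : (Fin d → ℝ) →L[ℝ] (Fin d → ℝ) := LinearMap.toContinuousLinearMap (toLin' A)
  have hdet : A'.det = A.det := by simp [A', ContinuousLinearMap.det]
  have hu : IsUnit A := (isUnit_iff_isUnit_det A).2 hA.isUnit
  have hd : ∀ w ∈ Set.univ, HasFDerivWithinAt f A' Set.univ w := fun w _ =>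
    (A'.hasFDerivAt.const_add m).hasFDerivWithinAt
  have hinj : Set.InjOn f Set.univ := fun v _ w _ h =>
    mulVec_injective_of_isUnit hu (add_left_cancel h)
  have himg : f '' Set.univ = Set.univ := by
    rw [Set.image_univ, Set.range_eq_univ]
    intro z
    obtain ⟨w, hw⟩ := mulVec_surjective_iff_isUnit.2 hu (z - m)
    exact ⟨w, by simp [f, hw]⟩
  have h1 := integrableOn_image_iff_integrableOn_abs_det_fderiv_smul volume MeasurableSet.univ
    hd hinj F
  have h2 := integral_image_eq_integral_abs_det_fderiv_smul volume MeasurableSet.univ hd hinj F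
  rw [himg] at h1 h2
  simp only [integrableOn_univ, setIntegral_univ, hdet] at h1 h2
  refine ⟨h1.2 (hF.smul _), ?_⟩
  rw [h2, integral_smul, Complex.real_smul]

lemma prod_gaussChar (σ : ℝ) (s w : Fin d → ℝ) :
    ∏ j, gaussChar σ (s j) (w j)
      = Complex.exp (-(σ : ℂ) * ((w ⬝ᵥ w : ℝ) : ℂ) - Complex.I * ((s ⬝ᵥ w : ℝ) : ℂ)) := by
  simp only [gaussChar, ← Complex.exp_sum, Finset.sum_sub_distrib, dotProduct, Complex.ofReal_sum,
    Complex.ofReal_mul, Finset.mul_sum, mul_assoc, pow_two]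

lemma prod_integral_gaussChar {σ : ℝ} (hσ : 0 < σ) (s : Fin d → ℝ) :
    ∏ j, ∫ w, gaussChar σ (s j) w
      = ((Real.sqrt (π / σ) ^ d : ℝ) : ℂ) * Complex.exp (-((s ⬝ᵥ s : ℝ) : ℂ) / (4 * σ)) := by
  simp only [integral_gaussChar hσ, Finset.prod_mul_distrib, ← Complex.exp_sum,
    Finset.prod_const, Finset.card_univ, Fintype.card_fin, ← Finset.sum_div,
    Finset.sum_neg_distrib, dotProduct, Complex.ofReal_sum, Complex.ofReal_mul,
    Complex.ofReal_pow, pow_two]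

lemma fourier_quadratic_mul_gaussian {σ : ℝ} (hσ : 0 < σ) {A V : Matrix (Fin d) (Fin d) ℝ}
    (hA : A.det ≠ 0) (hV : V = A * Aᵀ) (m t p : Fin d → ℝ) (B : Matrix (Fin d) (Fin d) ℝ) :
    Integrable (fun z : Fin d → ℝ =>
      ((Real.exp (-σ * ((z - m) ⬝ᵥ (V⁻¹ *ᵥ (z - m)))) *
        (1 + 2 * σ * ((z - m) ⬝ᵥ (V⁻¹ *ᵥ p)) +
          σ * (V⁻¹ * ((2 * σ) • vecMulVec (z - m) (z - m) * V⁻¹ - 1) * B).trace) : ℝ) : ℂ) *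
        Complex.exp (-Complex.I * ((t ⬝ᵥ z : ℝ) : ℂ))) ∧
    ∫ z : Fin d → ℝ,
      ((Real.exp (-σ * ((z - m) ⬝ᵥ (V⁻¹ *ᵥ (z - m)))) *
        (1 + 2 * σ * ((z - m) ⬝ᵥ (V⁻¹ *ᵥ p)) +
          σ * (V⁻¹ * ((2 * σ) • vecMulVec (z - m) (z - m) * V⁻¹ - 1) * B).trace) : ℝ) : ℂ) *
        Complex.exp (-Complex.I * ((t ⬝ᵥ z : ℝ) : ℂ))
      = ((|A.det| * Real.sqrt (π / σ) ^ d : ℝ) : ℂ) *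
        (Complex.exp (-Complex.I * ((m ⬝ᵥ t : ℝ) : ℂ) - ((t ⬝ᵥ (V *ᵥ t) : ℝ) : ℂ) / (4 * σ)) *
          (1 - Complex.I * ((t ⬝ᵥ p : ℝ) : ℂ) - (1 / 2) * ((t ⬝ᵥ (B *ᵥ t) : ℝ) : ℂ))) := by
  have hAu : IsUnit A.det := hA.isUnit
  have hAt : IsUnit Aᵀ.det := by rwa [det_transpose]
  obtain ⟨u, rfl⟩ : ∃ u, p = A *ᵥ u := ⟨A⁻¹ *ᵥ p, by simp [mul_nonsing_inv _ hAu]⟩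
  obtain ⟨C, rfl⟩ : ∃ C, B = A * C * Aᵀ :=
    ⟨A⁻¹ * B * Aᵀ⁻¹, by
      rw [Matrix.mul_assoc, Matrix.mul_assoc, nonsing_inv_mul _ hAt, Matrix.mul_one,
        mul_nonsing_inv_cancel_left _ _ hAu]⟩
  have hW : Aᵀ * V⁻¹ * A = 1 := by
    rw [hV, Matrix.mul_inv_rev, mul_nonsing_inv_cancel_left _ _ hAt, nonsing_inv_mul _ hAu]
  have hbil (v w : Fin d → ℝ) : (A *ᵥ v) ⬝ᵥ (V⁻¹ *ᵥ (A *ᵥ w)) = v ⬝ᵥ w := by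
    rw [← vecMul_transpose, ← dotProduct_mulVec, mulVec_mulVec, mulVec_mulVec, hW,
      one_mulVec]
  have htr (w : Fin d → ℝ) :
      (V⁻¹ * ((2 * σ) • vecMulVec (A *ᵥ w) (A *ᵥ w) * V⁻¹ - 1) * (A * C * Aᵀ)).trace
        = (((2 * σ) • vecMulVec w w - 1) * C).trace := by
    have hvec : vecMulVec (A *ᵥ w) (A *ᵥ w) = A * vecMulVec w w * Aᵀ := by
      rw [mul_vecMulVec, vecMulVec_mul, vecMul_transpose]
    have e : Aᵀ * (V⁻¹ * ((2 * σ) • (A * vecMulVec w w * Aᵀ) * V⁻¹ - 1)) * A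
        = (2 * σ) • vecMulVec w w - 1 := by
      calc _ = (2 * σ) • ((Aᵀ * V⁻¹ * A) * vecMulVec w w * (Aᵀ * V⁻¹ * A)) - Aᵀ * V⁻¹ * A := by
            simp only [Matrix.mul_sub, Matrix.sub_mul, Matrix.mul_smul, Matrix.smul_mul,
              Matrix.mul_one, Matrix.mul_assoc]
        _ = _ := by simp only [hW, Matrix.one_mul, Matrix.mul_one]
    rw [hvec, ← e, ← Matrix.mul_assoc, trace_mul_comm]
    simp only [Matrix.mul_assoc]
  set s : Fin d → ℝ := Aᵀ *ᵥ t with hs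
  have hst (w : Fin d → ℝ) : t ⬝ᵥ (A *ᵥ w) = s ⬝ᵥ w := by
    rw [hs, mulVec_transpose, dotProduct_mulVec]
  obtain ⟨hi, hv⟩ := quadratic_mul_gaussChar hσ s u C
  set c : ℂ := Complex.exp (-Complex.I * ((m ⬝ᵥ t : ℝ) : ℂ)) with hc
  set F : (Fin d → ℝ) → ℂ := fun z =>
      ((Real.exp (-σ * ((z - m) ⬝ᵥ (V⁻¹ *ᵥ (z - m)))) *
        (1 + 2 * σ * ((z - m) ⬝ᵥ (V⁻¹ *ᵥ (A *ᵥ u))) +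
          σ * (V⁻¹ * ((2 * σ) • vecMulVec (z - m) (z - m) * V⁻¹ - 1) *
            (A * C * Aᵀ)).trace) : ℝ) : ℂ) *
        Complex.exp (-Complex.I * ((t ⬝ᵥ z : ℝ) : ℂ)) with hF
  have hFw : (fun w => F (m + A *ᵥ w)) = fun w => c *
      ((((1 + 2 * σ * (w ⬝ᵥ u) + σ * (((2 * σ) • vecMulVec w w - 1) * C).trace : ℝ)) : ℂ) *
        ∏ j, gaussChar σ (s j) (w j)) := by
    funext w
    simp only [hF, add_sub_cancel_left, hbil, htr, dotProduct_add, hst, prod_gaussChar, hc,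
      dotProduct_comm t m]
    rw [Complex.ofReal_mul, Complex.ofReal_exp]
    have : Complex.exp (((-σ * (w ⬝ᵥ w) : ℝ)) : ℂ) *
        Complex.exp (-Complex.I * ((m ⬝ᵥ t + s ⬝ᵥ w : ℝ) : ℂ))
        = Complex.exp (-Complex.I * ((m ⬝ᵥ t : ℝ) : ℂ)) *
        Complex.exp (-(σ : ℂ) * ((w ⬝ᵥ w : ℝ) : ℂ) - Complex.I * ((s ⬝ᵥ w : ℝ) : ℂ)) := by
      rw [← Complex.exp_add, ← Complex.exp_add]
      congr 1
      push_cast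
      ring
    rw [mul_right_comm, this]
    ring
  obtain ⟨h1, h2⟩ := integral_comp_affine hA m (F := F) (by rw [hFw]; exact hi.const_mul c)
  refine ⟨h1, ?_⟩
  have hVt : t ⬝ᵥ (V *ᵥ t) = s ⬝ᵥ s := by
    rw [hV, ← mulVec_mulVec, hst]
  have hBt : t ⬝ᵥ ((A * C * Aᵀ) *ᵥ t) = s ⬝ᵥ (C *ᵥ s) := by
    rw [← mulVec_mulVec, ← mulVec_mulVec, hst]
  rw [h2, hFw, integral_const_mul, hv, prod_integral_gaussChar hσ, hVt, hBt, hst, sub_eq_add_neg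
    (-Complex.I * _), Complex.exp_add, ← hc, ← neg_div]
  push_cast
  ring

lemma two_pi_rpow_mul_sqrt_pow (d : ℕ) {σ : ℝ} (hσ : 0 < σ) :
    (2 * π) ^ (-(d : ℝ)) * Real.sqrt (π / σ) ^ d = (4 * π * σ) ^ (-(d : ℝ) / 2) := by
  have h4 : Real.sqrt (4 * π * σ) = 2 * π / Real.sqrt (π / σ) := by
    rw [eq_div_iff (by positivity), ← Real.sqrt_mul (by positivity),
      show 4 * π * σ * (π / σ) = (2 * π) ^ 2 by field_simp; ring, Real.sqrt_sq (by positivity)]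
  rw [neg_div, Real.rpow_neg (by positivity), Real.rpow_neg (by positivity),
    Real.rpow_div_two_eq_sqrt _ (by positivity), Real.rpow_natCast, Real.rpow_natCast, h4, div_pow,
    inv_div, inv_mul_eq_div]

open scoped MatrixOrder Matrix.Norms.L2Operator in
lemma exists_eq_mul_transpose {V : Matrix (Fin d) (Fin d) ℝ} (hV : V.PosSemidef) :
    ∃ A : Matrix (Fin d) (Fin d) ℝ, V = A * Aᵀ := by
  obtain ⟨D, hD⟩ := CStarAlgebra.nonneg_iff_eq_star_mul_self.1 hV.nonneg
  exact ⟨Dᵀ, by simpa [star_eq_conjTranspose] using hD⟩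

end Multivariate

/-- Fourier transform of the influence function (Eq. (E34)). -/
theorem fourier_transform_influence {d : ℕ} (hd : 1 ≤ d) (σ : ℝ) (hσ : 0 < σ)
    (m₀ : Fin d → ℝ) (S : Matrix (Fin d) (Fin d) ℝ) (hS : S.PosDef)
    (x t : Fin d → ℝ) :
    (((2 * π) ^ (-(d : ℝ)) : ℝ) : ℂ) *
      ∫ z : Fin d → ℝ, (fInfl σ m₀ S x z : ℂ) *
        Complex.exp (-Complex.I * ((t ⬝ᵥ z : ℝ) : ℂ)) =
    (((4 * π * σ) ^ (-(d : ℝ) / 2) : ℝ) : ℂ) *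
      (Complex.exp (-Complex.I * ((x ⬝ᵥ t : ℝ) : ℂ) - ((t ⬝ᵥ t : ℝ) : ℂ) / (4 * (σ : ℂ))) -
        Complex.exp (-Complex.I * ((m₀ ⬝ᵥ t : ℝ) : ℂ) -
            ((t ⬝ᵥ (Vm σ S *ᵥ t) : ℝ) : ℂ) / (4 * (σ : ℂ))) *
          (1 - Complex.I * ((t ⬝ᵥ (x - m₀) : ℝ) : ℂ) -
            (1 / 2) * ((t ⬝ᵥ (Bm m₀ S x *ᵥ t) : ℝ) : ℂ))) := by
  have hV : (Vm σ S).PosDef := Matrix.PosDef.one.add (hS.smul (by positivity))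
  obtain ⟨A, hA⟩ := exists_eq_mul_transpose hV.posSemidef
  have hdetV : (Vm σ S).det = A.det ^ 2 := by rw [hA, det_mul, det_transpose, pow_two]
  have hdet : A.det ≠ 0 := fun h => hV.det_pos.ne' (by simp [hdetV, h])
  have hdet' : (Vm σ S).det ^ (-(1 : ℝ) / 2) * |A.det| = 1 := by
    rw [hdetV, neg_div, Real.rpow_neg (by positivity), ← Real.sqrt_eq_rpow, Real.sqrt_sq_eq_abs,
      inv_mul_cancel₀ (abs_ne_zero.2 hdet)]
  obtain ⟨hi1, hv1⟩ := fourier_quadratic_mul_gaussian hσ (A := 1) (V := 1) (by simp) (by simp)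
    x t 0 0
  obtain ⟨hi2, hv2⟩ := fourier_quadratic_mul_gaussian hσ hdet hA m₀ t (x - m₀) (Bm m₀ S x)
  simp only [inv_one, one_mulVec, mulVec_zero, dotProduct_zero, mul_zero,
    trace_zero, add_zero, mul_one, det_one, abs_one, one_mul, zero_mulVec, Complex.ofReal_zero,
    sub_zero] at hi1 hv1
  have hdetC : (((Vm σ S).det ^ (-(1 : ℝ) / 2) : ℝ) : ℂ) * ((|A.det| : ℝ) : ℂ) = 1 := by
    exact_mod_cast hdet'
  have hsub := integral_sub hi1 (hi2.const_mul (((Vm σ S).det ^ (-(1 : ℝ) / 2) : ℝ) : ℂ))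
  rw [integral_const_mul, hv1, hv2, Complex.ofReal_mul |A.det|,
    ← mul_assoc (Complex.ofReal (_ ^ _)), ← mul_assoc (Complex.ofReal (_ ^ _)), hdetC, one_mul,
    ← mul_sub] at hsub
  rw [← two_pi_rpow_mul_sqrt_pow d hσ, Complex.ofReal_mul, mul_assoc, ← hsub]
  congr 1
  refine integral_congr_ae (ae_of_all _ fun z => ?_)
  simp only [fInfl]
  rw [mul_assoc (_ ^ _), Complex.ofReal_sub, Complex.ofReal_mul (_ ^ _), sub_mul,
    mul_assoc (Complex.ofReal (_ ^ _))]
end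

section
/- (Gaussian–Fourier integral with a linear factor, Eq. (E43).) Let V be a symmetric positive definite d×d real matrix, m, a ∈ ℝ^d and σ > 0. Then for every t ∈ ℝ^d, ∫_{ℝ^d} exp(−σ(z−m)ᵀV^{−1}(z−m)) · ((z−m)ᵀV^{−1}a) · exp(−i tᵀz) dz = −(i/(2σ)) (π/σ)^{d/2} det(V)^{1/2} exp(−i tᵀm − tᵀVt/(4σ)) · (tᵀa). -/
open MeasureTheory Matrix Real

/-- A complex Gaussian with an arbitrary linear term in the exponent has an integrable first
moment. -/
lemma integrable_mul_cexp_neg_mul_sq_add {b : ℂ} (hb : 0 < b.re) (c : ℂ) :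
    Integrable fun x : ℝ ↦ (x : ℂ) * Complex.exp (-b * (x : ℂ) ^ 2 + c * x) := by
  have hint (e : ℂ) : Integrable fun x : ℝ ↦
      Complex.exp (-b * (x : ℂ) ^ 2 + (c + e) * x) := by
    simpa using integrable_cexp_quadratic hb (c + e) 0
  refine ((hint 1).norm.add (hint (-1)).norm).mono' (by fun_prop) (.of_forall fun x ↦ ?_)
  have hx : |x| ≤ rexp x + rexp (-x) := by
    rcases abs_cases x with h | h <;>
      linarith [add_one_le_exp x, add_one_le_exp (-x), exp_pos x, exp_pos (-x)]
  have hexp (e : ℝ) : ‖Complex.exp (-b * (x : ℂ) ^ 2 + (c + e) * x)‖ =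
      rexp (e * x) * ‖Complex.exp (-b * (x : ℂ) ^ 2 + c * x)‖ := by
    rw [show -b * (x : ℂ) ^ 2 + (c + e) * x = ((e * x : ℝ) : ℂ) + (-b * (x : ℂ) ^ 2 + c * x) by
      push_cast; ring, Complex.exp_add, norm_mul, Complex.norm_exp_ofReal]
  have h₁ := hexp 1
  have h₂ := hexp (-1)
  push_cast at h₁ h₂
  rw [Pi.add_apply, h₁, h₂, norm_mul, Complex.norm_real, norm_eq_abs, ← add_mul, one_mul,
    neg_one_mul]
  gcongr

/-- Integration by parts for the first moment of a one-dimensional complex Gaussian. -/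
lemma integral_mul_cexp_neg_mul_sq_add {b : ℂ} (hb : 0 < b.re) (c : ℂ) :
    ∫ x : ℝ, (x : ℂ) * Complex.exp (-b * (x : ℂ) ^ 2 + c * x) =
      c / (2 * b) * ∫ x : ℝ, Complex.exp (-b * (x : ℂ) ^ 2 + c * x) := by
  have hb0 : b ≠ 0 := by rintro rfl; simp at hb
  have hint : Integrable fun x : ℝ ↦ Complex.exp (-b * (x : ℂ) ^ 2 + c * x) := by
    simpa using integrable_cexp_quadratic hb c 0
  have hmul := integrable_mul_cexp_neg_mul_sq_add hb c
  have hderiv (x : ℝ) : HasDerivAt (fun x : ℝ ↦ Complex.exp (-b * (x : ℂ) ^ 2 + c * x))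
      (-(2 * b) * ((x : ℂ) * Complex.exp (-b * (x : ℂ) ^ 2 + c * x)) +
        c * Complex.exp (-b * (x : ℂ) ^ 2 + c * x)) x := by
    have h : HasDerivAt (fun z : ℂ ↦ -b * z ^ 2 + c * z) (-b * (2 * x) + c) (x : ℂ) := by
      convert! ((hasDerivAt_pow 2 (x : ℂ)).const_mul (-b)).add
        ((hasDerivAt_id (x : ℂ)).const_mul c) using 1
      simp
    convert! h.cexp.comp_ofReal using 1
    ring
  have hzero := integral_eq_zero_of_hasDerivAt_of_integrable hderiv
    ((hmul.const_mul _).add (hint.const_mul _)) hint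
  rw [integral_add (hmul.const_mul _) (hint.const_mul _), integral_const_mul,
    integral_const_mul] at hzero
  rw [div_mul_eq_mul_div, eq_div_iff (mul_ne_zero two_ne_zero hb0)]
  linear_combination -hzero

/-- The integral of a linear form against an isotropic complex Gaussian. -/
lemma integral_sum_mul_cexp_neg_mul_sum_add {ι : Type*} [Fintype ι] {b : ℂ} (hb : 0 < b.re)
    (a c : ι → ℂ) :
    ∫ v : ι → ℝ, (∑ j, a j * v j) *
        Complex.exp (-b * ∑ i, (v i : ℂ) ^ 2 + ∑ i, c i * v i) =
      (∑ j, a j * c j) / (2 * b) *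
        ((π / b) ^ (Fintype.card ι / 2 : ℂ) * Complex.exp ((∑ i, c i ^ 2) / (4 * b))) := by
  classical
  let e (i : ι) (x : ℝ) : ℂ := Complex.exp (-b * (x : ℂ) ^ 2 + c i * x)
  let f (j i : ι) (x : ℝ) : ℂ := (if j = i then (x : ℂ) else 1) * e i x
  have he (v : ι → ℝ) : Complex.exp (-b * ∑ i, (v i : ℂ) ^ 2 + ∑ i, c i * v i) =
      ∏ i, e i (v i) := by
    rw [Finset.mul_sum, ← Finset.sum_add_distrib, Complex.exp_sum]
  have hf (j : ι) (v : ι → ℝ) : (v j : ℂ) * ∏ i, e i (v i) = ∏ i, f j i (v i) := by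
    simp only [f, Finset.prod_mul_distrib, Finset.prod_ite_eq, Finset.mem_univ, if_true]
  have hfint (j i : ι) : Integrable (f j i) := by
    by_cases h : j = i
    · simpa [f, h, e] using integrable_mul_cexp_neg_mul_sq_add hb (c i)
    · simpa [f, h, e] using integrable_cexp_quadratic hb (c i) 0
  have hfI (j i : ι) : ∫ x, f j i x = (if j = i then c i / (2 * b) else 1) * ∫ x, e i x := by
    by_cases h : j = i
    · simpa [f, h, e] using integral_mul_cexp_neg_mul_sq_add hb (c i)
    · simp [f, h]
  have hprod (j : ι) : Integrable fun v : ι → ℝ ↦ ∏ i, f j i (v i) :=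
    Integrable.fintype_prod (hfint j)
  rw [← GaussianFourier.integral_cexp_neg_mul_sum_add hb c]
  simp_rw [he, Finset.sum_mul, mul_assoc, hf]
  rw [integral_finsetSum _ fun j _ ↦ (hprod j).const_mul _,
    integral_fintype_prod_volume_eq_prod, Finset.sum_div, Finset.sum_mul]
  refine Finset.sum_congr rfl fun j _ ↦ ?_
  rw [integral_const_mul, integral_fintype_prod_volume_eq_prod]
  simp_rw [hfI]
  rw [Finset.prod_mul_distrib, Finset.prod_ite_eq, if_pos (Finset.mem_univ j)]
  ring

/-- Linear change of variables for the Lebesgue integral on `ι → ℝ`. -/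
lemma integral_eq_abs_det_smul_integral_comp_mulVec {ι E : Type*} [Fintype ι] [DecidableEq ι]
    [NormedAddCommGroup E] [NormedSpace ℝ E] {B : Matrix ι ι ℝ} (hB : B.det ≠ 0)
    (g : (ι → ℝ) → E) :
    ∫ z, g z = |B.det| • ∫ y, g (B *ᵥ y) := by
  have hunit : IsUnit B.det := hB.isUnit
  let L : (ι → ℝ) ≃L[ℝ] (ι → ℝ) :=
    (toLin'OfInv (B.nonsing_inv_mul hunit) (B.mul_nonsing_inv hunit)).toContinuousLinearEquiv
  have hL : (L : (ι → ℝ) → ι → ℝ) = toLin' B := by ext; simp [L]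
  have h : ∫ y, g (B *ᵥ y) = ∫ z, g z ∂(Measure.map (toLin' B) volume) := by
    have hemb : MeasurableEmbedding (toLin' B) := hL ▸ L.toHomeomorph.measurableEmbedding
    simp [hemb.integral_map]
  rw [h, Real.map_matrix_volume_pi_eq_smul_volume_pi hB, integral_smul_measure,
    ENNReal.toReal_ofReal (abs_nonneg _), abs_inv, smul_inv_smul₀ (abs_ne_zero.mpr hB)]

open scoped MatrixOrder in
/-- A real positive definite matrix factors as `B * Bᵀ` with `B` invertible. -/
lemma Matrix.PosDef.exists_eq_mul_transpose {n : Type*} [Fintype n] [DecidableEq n]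
    {V : Matrix n n ℝ} (hV : V.PosDef) :
    ∃ B : Matrix n n ℝ, B.det ≠ 0 ∧ V = B * Bᵀ := by
  obtain ⟨y, hy⟩ := CStarAlgebra.nonneg_iff_eq_star_mul_self.mp hV.posSemidef.nonneg
  rw [star_eq_conjTranspose, conjTranspose_eq_transpose_of_trivial] at hy
  refine ⟨yᵀ, fun h ↦ hV.det_pos.ne' ?_, by simpa using hy⟩
  rw [hy, det_mul, h, zero_mul]

/-- Gaussian–Fourier integral with a linear factor (Eq. (E43)):
`∫ exp(−σ(z−m)ᵀV⁻¹(z−m)) ((z−m)ᵀV⁻¹a) exp(−i tᵀz) dz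
  = −(i/(2σ)) (π/σ)^{d/2} det(V)^{1/2} exp(−i tᵀm − tᵀVt/(4σ)) (tᵀa)`. -/
theorem gaussian_fourier_linear {d : ℕ} (hd : 1 ≤ d)
    (V : Matrix (Fin d) (Fin d) ℝ) (hV : V.PosDef)
    (m a : Fin d → ℝ) (σ : ℝ) (hσ : 0 < σ) (t : Fin d → ℝ) :
    ∫ z : Fin d → ℝ,
        ((Real.exp (-σ * ((z - m) ⬝ᵥ (V⁻¹ *ᵥ (z - m)))) *
          ((z - m) ⬝ᵥ (V⁻¹ *ᵥ a)) : ℝ) : ℂ) *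
          Complex.exp (-Complex.I * ((t ⬝ᵥ z : ℝ) : ℂ)) =
      -(Complex.I / (2 * (σ : ℂ))) * (((π / σ) ^ ((d : ℝ) / 2) : ℝ) : ℂ) *
        ((V.det ^ ((1 : ℝ) / 2) : ℝ) : ℂ) *
        Complex.exp (-Complex.I * ((t ⬝ᵥ m : ℝ) : ℂ) -
          ((t ⬝ᵥ (V *ᵥ t) : ℝ) : ℂ) / (4 * (σ : ℂ))) *
        ((t ⬝ᵥ a : ℝ) : ℂ) := by
  obtain ⟨B, hB, rfl⟩ := hV.exists_eq_mul_transpose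
  have hunit : IsUnit B.det := hB.isUnit
  have hBt : Bᵀ * (B * Bᵀ)⁻¹ = B⁻¹ := by
    rw [Matrix.mul_inv_rev, ← Matrix.mul_assoc, mul_nonsing_inv _ (by rwa [det_transpose]),
      Matrix.one_mul]
  have hdet : (B * Bᵀ).det ^ ((1 : ℝ) / 2) = |B.det| := by
    rw [det_mul, det_transpose, ← sqrt_eq_rpow, sqrt_mul_self_eq_abs]
  have hlin (y u : Fin d → ℝ) : (B *ᵥ y) ⬝ᵥ ((B * Bᵀ)⁻¹ *ᵥ u) = y ⬝ᵥ (B⁻¹ *ᵥ u) := by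
    rw [← vecMul_transpose, ← dotProduct_mulVec, mulVec_mulVec, hBt]
  have hquad (y : Fin d → ℝ) : (B *ᵥ y) ⬝ᵥ ((B * Bᵀ)⁻¹ *ᵥ (B *ᵥ y)) = y ⬝ᵥ y := by
    rw [hlin, mulVec_mulVec, nonsing_inv_mul _ hunit, one_mulVec]
  have hfreq (y : Fin d → ℝ) : t ⬝ᵥ (B *ᵥ y) = (Bᵀ *ᵥ t) ⬝ᵥ y := by
    rw [dotProduct_mulVec, mulVec_transpose]
  have hta : t ⬝ᵥ a = (B⁻¹ *ᵥ a) ⬝ᵥ (Bᵀ *ᵥ t) := by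
    rw [dotProduct_comm (B⁻¹ *ᵥ a), ← hfreq, mulVec_mulVec, mul_nonsing_inv _ hunit, one_mulVec]
  have htt : t ⬝ᵥ ((B * Bᵀ) *ᵥ t) = (Bᵀ *ᵥ t) ⬝ᵥ (Bᵀ *ᵥ t) := by
    rw [← mulVec_mulVec, hfreq]
  have hpow : (((π / σ) ^ ((d : ℝ) / 2) : ℝ) : ℂ) = ((π : ℂ) / σ) ^ ((d : ℂ) / 2) := by
    rw [Complex.ofReal_cpow (by positivity)]
    push_cast
    rfl
  have key := integral_sum_mul_cexp_neg_mul_sum_add (b := (σ : ℂ)) (by simpa using hσ)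
    (fun j ↦ (((B⁻¹ *ᵥ a) j : ℝ) : ℂ)) (fun j ↦ -Complex.I * (((Bᵀ *ᵥ t) j : ℝ) : ℂ))
  rw [← integral_add_right_eq_self _ m, integral_eq_abs_det_smul_integral_comp_mulVec hB]
  simp_rw [add_sub_cancel_right, hquad, hlin, dotProduct_add, hfreq]
  rw [hdet, hpow, htt, hta, sub_eq_add_neg, Complex.exp_add, Complex.real_smul]
  generalize B⁻¹ *ᵥ a = u at *
  generalize Bᵀ *ᵥ t = s at *
  have hintegrand (y : Fin d → ℝ) :
      ((Real.exp (-σ * (y ⬝ᵥ y)) * (y ⬝ᵥ u) : ℝ) : ℂ) *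
          Complex.exp (-Complex.I * ((s ⬝ᵥ y + t ⬝ᵥ m : ℝ) : ℂ)) =
        Complex.exp (-Complex.I * ((t ⬝ᵥ m : ℝ) : ℂ)) *
          ((∑ j, (u j : ℂ) * y j) * Complex.exp (-(σ : ℂ) * ∑ i, (y i : ℂ) ^ 2 +
            ∑ i, -Complex.I * (s i : ℂ) * y i)) := by
    have h₁ : ((y ⬝ᵥ u : ℝ) : ℂ) = ∑ j, (u j : ℂ) * y j := by
      simp [dotProduct, mul_comm]
    have h₂ : ((y ⬝ᵥ y : ℝ) : ℂ) = ∑ j, (y j : ℂ) ^ 2 := by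
      simp [dotProduct, sq]
    have h₃ : -Complex.I * ((s ⬝ᵥ y : ℝ) : ℂ) = ∑ i, -Complex.I * (s i : ℂ) * y i := by
      simp [dotProduct, Finset.mul_sum, mul_assoc]
    rw [← h₁, ← h₂, ← h₃, Complex.exp_add]
    push_cast
    rw [mul_add, Complex.exp_add]
    ring
  have hus : ∑ j, (u j : ℂ) * (-Complex.I * (s j : ℂ)) = -Complex.I * ((u ⬝ᵥ s : ℝ) : ℂ) := by
    simp only [dotProduct, Complex.ofReal_sum, Complex.ofReal_mul, Finset.mul_sum]
    exact Finset.sum_congr rfl fun j _ ↦ by ring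
  have hss : ∑ j, (-Complex.I * (s j : ℂ)) ^ 2 = -((s ⬝ᵥ s : ℝ) : ℂ) := by
    simp [dotProduct, mul_pow, ← sq]
  simp_rw [hintegrand]
  rw [integral_const_mul, key, hus, hss, Fintype.card_fin, neg_div]
  ring
end
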